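/- Suppose a group G acts specially on a quasi-median graph X, and let D ∈ ℕ be such that every vertex of the quotient graph ΔX/G has at most D neighbours. Then for any vertices v, w of X, there exist at most (D+1)² hyperplanes H of X such that w lies in the carrier N(H) but w is not the gate for v in N(H). -/

import Mathlib

namespace QM

variable {V : Type*}

/-- `y₁` and `y₂` lie (in this order) on a common geodesic from `x₁` to `x₂`. -/
def OnGeod (X : SimpleGraph V) (x₁ y₁ y₂ x₂ : V) : Prop :=
  X.dist x₁ y₁ + X.dist y₁ y₂ + X.dist y₂ x₂ = X.dist x₁ x₂

/-- `(y₁, y₂, y₃)` is a `k`-quasi-median triple for `(x₁, x₂, x₃)` (without minimality). -/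
def IsQMTriple (X : SimpleGraph V) (x₁ x₂ x₃ y₁ y₂ y₃ : V) (k : ℕ) : Prop :=
  OnGeod X x₁ y₁ y₂ x₂ ∧ OnGeod X x₁ y₁ y₃ x₃ ∧ OnGeod X x₂ y₂ y₃ x₃ ∧
    X.dist y₁ y₂ = k ∧ X.dist y₁ y₃ = k ∧ X.dist y₂ y₃ = k

/-- `y` is a quasi-median of the triple `(x₁, x₂, x₃)`: it is a `k`-quasi-median triple
with `k` as small as possible. -/
def IsQuasiMedianTriple (X : SimpleGraph V) (x₁ x₂ x₃ : V) (y : V × V × V) : Prop :=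
  ∃ k : ℕ, IsQMTriple X x₁ x₂ x₃ y.1 y.2.1 y.2.2 k ∧
    ∀ (k' : ℕ) (z₁ z₂ z₃ : V), IsQMTriple X x₁ x₂ x₃ z₁ z₂ z₃ k' → k ≤ k'

/-- The complete multipartite graph `K_{1,1,2}`: the complete graph on four vertices
with the edge between vertices `2` and `3` removed. -/
def K112 : SimpleGraph (Fin 4) :=
  SimpleGraph.fromRel (fun i j => ¬(i = 2 ∧ j = 3) ∧ ¬(i = 3 ∧ j = 2))

/-- The 1-skeleton of the 3-cube. -/
def cubeGraph : SimpleGraph (Fin 3 → Bool) :=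
  SimpleGraph.fromRel (fun x y => ∃! i, x i ≠ y i)

/-- The 6-cycle. -/
def C6 : SimpleGraph (Fin 6) := SimpleGraph.fromRel (fun i j => j = i + 1)

/-- A set of vertices is convex if it contains every vertex lying on a geodesic between
two of its members. -/
def IsConvexSet (X : SimpleGraph V) (S : Set V) : Prop :=
  ∀ x ∈ S, ∀ y ∈ S, ∀ z : V, X.dist x z + X.dist z y = X.dist x y → z ∈ S

/-- The convex hull of a set of vertices. -/
def convexHullSet (X : SimpleGraph V) (S : Set V) : Set V :=
  ⋂₀ {T : Set V | S ⊆ T ∧ IsConvexSet X T}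

/-- A quasi-median graph: a connected graph in which every triple of vertices has a unique
quasi-median, with no induced `K_{1,1,2}`, and in which the convex hull of every isometrically
embedded 6-cycle is isomorphic to the 3-cube. -/
structure IsQuasiMedian (X : SimpleGraph V) : Prop where
  connected : X.Connected
  uniqueQuasiMedian : ∀ x₁ x₂ x₃ : V, ∃! y : V × V × V, IsQuasiMedianTriple X x₁ x₂ x₃ y
  noK112 : IsEmpty (SimpleGraph.Embedding K112 X)
  hullOfC6IsCube : ∀ f : Fin 6 → V,
    (∀ i j, C6.Adj i j → X.Adj (f i) (f j)) →
    (∀ i j, X.dist (f i) (f j) = C6.dist i j) →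
    Nonempty (SimpleGraph.Iso
      (SimpleGraph.induce (convexHullSet X (Set.range f)) X) cubeGraph)

/-- Two edges are two sides of a common triangle, or opposite sides of a common square. -/
def SideRel (X : SimpleGraph V) (e f : Sym2 V) : Prop :=
  (∃ a b c : V, X.Adj a b ∧ X.Adj a c ∧ X.Adj b c ∧ e = s(a, b) ∧ f = s(a, c)) ∨
  (∃ a b c d : V, X.Adj a b ∧ X.Adj c d ∧ X.Adj a c ∧ X.Adj b d ∧ a ≠ d ∧ b ≠ c ∧
    e = s(a, b) ∧ f = s(c, d))

/-- The equivalence class of an edge under the equivalence relation generated by `SideRel`. -/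
def hypClass (X : SimpleGraph V) (e : Sym2 V) : Set (Sym2 V) :=
  {f | Relation.EqvGen (SideRel X) e f}

/-- A hyperplane: the equivalence class of some edge of `X`. -/
def IsHyperplane (X : SimpleGraph V) (H : Set (Sym2 V)) : Prop :=
  ∃ e ∈ X.edgeSet, H = hypClass X e

/-- The type of hyperplanes of `X`. -/
def Hyperplane (X : SimpleGraph V) := {H : Set (Sym2 V) // IsHyperplane X H}

/-- Edges `e`, `e'` sharing the endpoint `p`, not lying in a common clique, that are
adjacent sides of a square of `X`: their dual hyperplanes intersect at `p`. -/
def IntersectAt (X : SimpleGraph V) (e e' : Sym2 V) (p : V) : Prop :=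
  ∃ a b : V, e = s(p, a) ∧ e' = s(p, b) ∧ X.Adj p a ∧ X.Adj p b ∧ a ≠ b ∧ ¬ X.Adj a b ∧
    ∃ q : V, q ≠ p ∧ X.Adj a q ∧ X.Adj b q

/-- Edges `e`, `e'` sharing the endpoint `p`, not lying in a common clique, and not adjacent
sides of any square of `X`: their dual hyperplanes osculate at `p`. -/
def OsculateAt (X : SimpleGraph V) (e e' : Sym2 V) (p : V) : Prop :=
  ∃ a b : V, e = s(p, a) ∧ e' = s(p, b) ∧ X.Adj p a ∧ X.Adj p b ∧ a ≠ b ∧ ¬ X.Adj a b ∧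
    ¬ ∃ q : V, q ≠ p ∧ X.Adj a q ∧ X.Adj b q

/-- Hyperplanes `H` and `H'` intersect at `p`. -/
def HypIntersectAt (X : SimpleGraph V) (H H' : Hyperplane X) (p : V) : Prop :=
  ∃ e ∈ H.1, ∃ e' ∈ H'.1, IntersectAt X e e' p

/-- Hyperplanes `H` and `H'` osculate at `p`. -/
def HypOsculateAt (X : SimpleGraph V) (H H' : Hyperplane X) (p : V) : Prop :=
  ∃ e ∈ H.1, ∃ e' ∈ H'.1, OsculateAt X e e' p

/-- Hyperplanes `H` and `H'` intersect. -/
def HypIntersect (X : SimpleGraph V) (H H' : Hyperplane X) : Prop :=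
  ∃ p : V, HypIntersectAt X H H' p

/-- Hyperplanes `H` and `H'` osculate. -/
def HypOsculate (X : SimpleGraph V) (H H' : Hyperplane X) : Prop :=
  ∃ p : V, HypOsculateAt X H H' p

/-- The contact graph `𝒞X`: hyperplanes are adjacent iff they intersect or osculate. -/
def contactGraph (X : SimpleGraph V) : SimpleGraph (Hyperplane X) :=
  SimpleGraph.fromRel (fun H H' => HypIntersect X H H' ∨ HypOsculate X H H')

/-- The crossing graph `ΔX`: hyperplanes are adjacent iff they intersect. -/
def crossingGraph (X : SimpleGraph V) : SimpleGraph (Hyperplane X) :=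
  SimpleGraph.fromRel (fun H H' => HypIntersect X H H')

/-- The (vertex set of the) carrier of a hyperplane: all endpoints of its edges. -/
def hypCarrier (X : SimpleGraph V) (H : Hyperplane X) : Set V :=
  {v : V | ∃ e ∈ H.1, v ∈ e}

/-- A set of edges `H` (e.g. a hyperplane) separates `p` from `q` if every walk from `p`
to `q` uses an edge of `H`. -/
def Separates (X : SimpleGraph V) (H : Set (Sym2 V)) (p q : V) : Prop :=
  ∀ w : X.Walk p q, ∃ e ∈ w.edges, e ∈ H

/-- `f` is a `(λ, c)`-quasi-isometry from `(A, dA)` to `(B, dB)`. -/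
def IsQuasiIsometry {A B : Type*} (lam c : ℝ) (dA : A → A → ℝ) (dB : B → B → ℝ)
    (f : A → B) : Prop :=
  (∀ x y : A, dA x y / lam - c ≤ dB (f x) (f y) ∧ dB (f x) (f y) ≤ lam * dA x y + c) ∧
    ∀ b : B, ∃ a : A, dB (f a) b ≤ c

end QM

namespace QM

variable {V : Type*} {G : Type*} [Group G]

/-- An action of a group `G` on a graph `X` by graph automorphisms. -/
structure GraphAction (G : Type*) [Group G] {V : Type*} (X : SimpleGraph V) where
  act : G → V → V
  act_one : ∀ v, act 1 v = v
  act_mul : ∀ g h v, act (g * h) v = act g (act h v)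
  act_adj : ∀ g a b, X.Adj (act g a) (act g b) ↔ X.Adj a b

/-- The image of a set of edges under the action of `g`. -/
def GraphAction.hypImage {X : SimpleGraph V} (α : GraphAction G X) (g : G)
    (H : Set (Sym2 V)) : Set (Sym2 V) :=
  Sym2.map (α.act g) '' H

/-- Two hyperplanes are in the same orbit of the induced action of `G` on hyperplanes. -/
def SameOrbit {X : SimpleGraph V} (α : GraphAction G X) (H H' : Hyperplane X) : Prop :=
  ∃ g : G, H'.1 = α.hypImage g H.1

/-- The set of `G`-orbits of hyperplanes. -/
def HypOrbit {X : SimpleGraph V} (α : GraphAction G X) := Quot (SameOrbit α)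

/-- The quotient graph `ΔX/G`: vertices are `G`-orbits of hyperplanes, two orbits being
adjacent iff some representatives are adjacent in the crossing graph `ΔX`. -/
def quotCrossingGraph {X : SimpleGraph V} (α : GraphAction G X) :
    SimpleGraph (HypOrbit α) :=
  SimpleGraph.fromRel (fun O O' => ∃ H H' : Hyperplane X,
    Quot.mk (SameOrbit α) H = O ∧ Quot.mk (SameOrbit α) H' = O' ∧ (crossingGraph X).Adj H H')

/-- Every vertex of the quotient graph `ΔX/G` has at most `D` neighbours. -/
def QuotDegBounded {X : SimpleGraph V} (α : GraphAction G X) (D : ℕ) : Prop :=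
  ∀ O : HypOrbit α, ((quotCrossingGraph α).neighborSet O).Finite ∧
    ((quotCrossingGraph α).neighborSet O).ncard ≤ D

/-- The action is special: (i) no two distinct hyperplanes in the same `G`-orbit intersect
or osculate; (ii) if two hyperplanes intersect, then no `G`-translate of the first osculates
with the second. -/
def IsSpecial {X : SimpleGraph V} (α : GraphAction G X) : Prop :=
  (∀ H H' : Hyperplane X, SameOrbit α H H' → H ≠ H' →
      ¬(HypIntersect X H H' ∨ HypOsculate X H H')) ∧
  (∀ H H' K : Hyperplane X, HypIntersect X H H' → SameOrbit α H K →
      ¬ HypOsculate X K H')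

/-- The `g`-translate of the hyperplane `A` is within contact-graph distance `ε` of `A`. -/
def TranslateDistLE {X : SimpleGraph V} (α : GraphAction G X) (g : G)
    (A : Hyperplane X) (ε : ℝ) : Prop :=
  ∃ A' : Hyperplane X, A'.1 = α.hypImage g A.1 ∧ ((contactGraph X).dist A A' : ℝ) ≤ ε

end QM

namespace QM

/-- `p` is a gate for `v` in the (full subgraph spanned by the) vertex set `S`. -/
def IsGate {V : Type*} (X : SimpleGraph V) (S : Set V) (v p : V) : Prop :=
  p ∈ S ∧ ∀ q ∈ S, X.dist v p + X.dist p q = X.dist v q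


section QuasiMedianGraph

variable {V : Type*} {X : SimpleGraph V}

theorem dist_le_dist_add_one (hX : IsQuasiMedian X) {a b : V} (h : X.Adj a b) (x : V) :
    X.dist x a ≤ X.dist x b + 1 := by
  have := hX.connected.dist_triangle (u := x) (v := b) (w := a)
  rwa [SimpleGraph.dist_eq_one_iff_adj.2 h.symm] at this

theorem dist_eq_two {a b c : V} (hab : X.Adj a b) (hac : X.Adj a c) (hbc : b ≠ c)
    (hn : ¬ X.Adj b c) : X.dist b c = 2 := by
  have hle : X.dist b c ≤ 2 :=
    SimpleGraph.dist_le (.cons hab.symm (.cons hac .nil))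
  have h0 : X.dist b c ≠ 0 := fun h =>
    hbc ((SimpleGraph.Reachable.dist_eq_zero_iff ⟨.cons hab.symm (.cons hac .nil)⟩).1 h)
  have h1 : X.dist b c ≠ 1 := fun h => hn (SimpleGraph.dist_eq_one_iff_adj.1 h)
  omega

/-- Two common neighbours of the endpoints of an edge are equal or adjacent. -/
theorem adj_of_common_triangle (hX : IsQuasiMedian X) {a b c d : V} (hab : X.Adj a b)
    (hac : X.Adj a c) (hbc : X.Adj b c) (had : X.Adj a d) (hbd : X.Adj b d) (hcd : c ≠ d) :
    X.Adj c d := by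
  by_contra hn
  refine hX.noK112.false ⟨⟨![a, b, c, d], ?_⟩, ?_⟩
  · intro i j h
    have := hab.ne; have := hac.ne; have := hbc.ne; have := had.ne; have := hbd.ne
    fin_cases i <;> fin_cases j <;> simp_all
  · have hn' : ¬ X.Adj d c := fun h => hn h.symm
    intro i j
    change X.Adj (![a, b, c, d] i) (![a, b, c, d] j) ↔ K112.Adj i j
    fin_cases i <;> fin_cases j <;>
      simp [K112, hab, hac, hbc, had, hbd, hn, hn', hab.symm, hac.symm, hbc.symm, had.symm,
        hbd.symm]

theorem triangle_condition (hX : IsQuasiMedian X) {x p q : V} (hpq : X.Adj p q)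
    (hd : X.dist x p = X.dist x q) :
    ∃ z, X.Adj z p ∧ X.Adj z q ∧ X.dist x z + 1 = X.dist x p := by
  obtain ⟨⟨y₁, y₂, y₃⟩, ⟨k, ⟨h12, h13, h23, k12, k13, k23⟩, -⟩, -⟩ :=
    hX.uniqueQuasiMedian x p q
  simp only [OnGeod] at *
  have h1 := SimpleGraph.dist_eq_one_iff_adj.2 hpq
  have zero : ∀ {a b : V}, X.dist a b = 0 → a = b := fun h => hX.connected.dist_eq_zero_iff.1 h
  have c1 := SimpleGraph.dist_comm (G := X) (u := p) (v := y₂)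
  have c2 := SimpleGraph.dist_comm (G := X) (u := q) (v := y₃)
  have hk : k = 1 := by
    have : k ≠ 0 := by
      rintro rfl
      have := zero k12
      have := zero k13
      subst_vars
      omega
    omega
  subst hk
  have e2 := zero (a := p) (b := y₂) (by omega)
  have e3 := zero (a := q) (b := y₃) (by omega)
  subst_vars
  exact ⟨y₁, SimpleGraph.dist_eq_one_iff_adj.1 k12, SimpleGraph.dist_eq_one_iff_adj.1 k13,
    by omega⟩

/-- There is no induced `K_{2,3}`. -/
theorem eq_or_eq_or_eq_of_common_adj (hX : IsQuasiMedian X) {a b x y z : V} (hne : a ≠ b)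
    (hn : ¬ X.Adj a b) (hax : X.Adj a x) (hay : X.Adj a y) (haz : X.Adj a z)
    (hbx : X.Adj b x) (hby : X.Adj b y) (hbz : X.Adj b z) : x = y ∨ x = z ∨ y = z := by
  by_contra! hc
  obtain ⟨hxy, hxz, hyz⟩ := hc
  have key : ∀ {s t : V}, X.Adj a s → X.Adj a t → X.Adj b s → X.Adj b t → s ≠ t →
      X.dist s t = 2 := fun has hat hbs hbt hst =>
    dist_eq_two has hat hst fun h =>
      hn (adj_of_common_triangle hX h has.symm hat.symm hbs.symm hbt.symm hne)
  have kxy := key hax hay hbx hby hxy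
  have kxz := key hax haz hbx hbz hxz
  have kyz := key hay haz hby hbz hyz
  have med : ∀ {c : V}, X.Adj c x → X.Adj c y → X.Adj c z →
      IsQuasiMedianTriple X x y z (c, c, c) := by
    intro c hx hy hz
    refine ⟨0, ?_, fun _ _ _ _ _ => Nat.zero_le _⟩
    simp [IsQMTriple, OnGeod, kxy, kxz, kyz, SimpleGraph.dist_eq_one_iff_adj.2 hx.symm,
      SimpleGraph.dist_eq_one_iff_adj.2 hy, SimpleGraph.dist_eq_one_iff_adj.2 hy.symm,
      SimpleGraph.dist_eq_one_iff_adj.2 hz]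
  have := (hX.uniqueQuasiMedian x y z).unique (med hax hay haz) (med hbx hby hbz)
  exact hne (congrArg Prod.fst this)

theorem cubeGraph_adj_iff {x y : Fin 3 → Bool} :
    cubeGraph.Adj x y ↔ ∃ i, y = Function.update x i (!x i) := by
  revert x y
  unfold cubeGraph ExistsUnique
  decide

theorem cubeGraph_exists_adj {a p v z w : Fin 3 → Bool} (hap : cubeGraph.Adj a p)
    (hpv : cubeGraph.Adj p v) (hvz : cubeGraph.Adj v z) (hzw : cubeGraph.Adj z w)
    (hav : a ≠ v) (hpz : p ≠ z) (hvw : v ≠ w) (haz : ¬ cubeGraph.Adj a z)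
    (hpw : ¬ cubeGraph.Adj p w) :
    ∃ m, cubeGraph.Adj a m ∧ cubeGraph.Adj m v ∧ cubeGraph.Adj m w := by
  obtain ⟨i, rfl⟩ := cubeGraph_adj_iff.1 hap
  obtain ⟨j, rfl⟩ := cubeGraph_adj_iff.1 hpv
  obtain ⟨k, rfl⟩ := cubeGraph_adj_iff.1 hvz
  obtain ⟨l, rfl⟩ := cubeGraph_adj_iff.1 hzw
  simp only [cubeGraph_adj_iff] at *
  clear hap hpv hvz hzw
  refine ⟨Function.update a j (!a j), ⟨j, rfl⟩, ?_⟩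
  revert a i j k l
  decide +kernel

/-- In an isometric hexagon, the first, third and fifth vertices have a common neighbour. -/
theorem exists_adj_of_isometric_hexagon (hX : IsQuasiMedian X) {a p v z w q : V}
    (hap : X.Adj a p) (hpv : X.Adj p v) (hvz : X.Adj v z) (hzw : X.Adj z w) (hwq : X.Adj w q)
    (hqa : X.Adj q a) (hav : X.dist a v = 2) (hpz : X.dist p z = 2) (hvw : X.dist v w = 2)
    (hzq : X.dist z q = 2) (hwa : X.dist w a = 2) (hqp : X.dist q p = 2)
    (haz : X.dist a z = 3) (hpw : X.dist p w = 3) (hvq : X.dist v q = 3) :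
    ∃ m, X.Adj a m ∧ X.Adj m v ∧ X.Adj m w := by
  let f : Fin 6 → V := ![a, p, v, z, w, q]
  have h1 : ∀ i, X.Adj (f i) (f (i + 1)) := by
    intro i
    fin_cases i <;> assumption
  have h2 : ∀ i, X.dist (f i) (f (i + 2)) = 2 := by
    intro i
    fin_cases i <;> assumption
  have h3 : ∀ i, X.dist (f i) (f (i + 3)) = 3 := by
    intro i
    fin_cases i <;> first | assumption | (rw [SimpleGraph.dist_comm]; assumption)
  have hf : ∀ i j, C6.Adj i j → X.Adj (f i) (f j) := by
    intro i j h
    rcases ((SimpleGraph.fromRel_adj _ _ _).1 h).2 with rfl | rfl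
    exacts [h1 i, (h1 j).symm]
  have hadj : ∀ i : Fin 6, C6.Adj i (i + 1) := by
    unfold C6
    decide
  have of_walk : ∀ {i j : Fin 6} (W : C6.Walk i j), X.dist (f i) (f j) = W.length →
      X.dist (f i) (f j) = C6.dist i j := by
    intro i j W hW
    obtain ⟨p, hp⟩ := W.reachable.exists_walk_length_eq_dist
    let φ : C6 →g X := ⟨f, fun {a b} h => hf a b h⟩
    have := SimpleGraph.dist_le (p.map φ)
    rw [SimpleGraph.Walk.length_map, hp] at this
    exact le_antisymm this (hW ▸ SimpleGraph.dist_le W)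
  have short : ∀ i k : Fin 6, k ≤ 3 → X.dist (f i) (f (i + k)) = C6.dist i (i + k) := by
    intro i k hk
    have e2 : i + 1 + 1 = i + 2 := by rw [add_assoc]; rfl
    have e3 : i + 1 + 1 + 1 = i + 3 := by rw [add_assoc, add_assoc]; rfl
    obtain rfl | rfl | rfl | rfl : k = 0 ∨ k = 1 ∨ k = 2 ∨ k = 3 := by revert k; decide
    · simp
    · exact of_walk (hadj i).toWalk (SimpleGraph.dist_eq_one_iff_adj.2 (h1 i))
    · have := h2 i
      rw [← e2] at this ⊢
      exact of_walk (.cons (hadj i) (.cons (hadj _) .nil)) this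
    · have := h3 i
      rw [← e3] at this ⊢
      exact of_walk (.cons (hadj i) (.cons (hadj _) (.cons (hadj _) .nil))) this
  have isom : ∀ i j, X.dist (f i) (f j) = C6.dist i j := by
    intro i j
    obtain h | h : j - i ≤ 3 ∨ i - j ≤ 3 := by revert i j; decide
    · simpa using short i _ h
    · rw [SimpleGraph.dist_comm, SimpleGraph.dist_comm (u := i)]
      simpa using short j _ h
  obtain ⟨φ⟩ := hX.hullOfC6IsCube f hf isom
  have mem : ∀ i, f i ∈ convexHullSet X (Set.range f) := fun i T hT => hT.1 ⟨i, rfl⟩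
  have adj : ∀ {i j}, X.Adj (f i) (f j) → cubeGraph.Adj (φ ⟨f i, mem i⟩) (φ ⟨f j, mem j⟩) :=
    fun h => φ.map_adj_iff.2 h
  have nadj : ∀ {i j}, X.dist (f i) (f j) = 3 →
      ¬ cubeGraph.Adj (φ ⟨f i, mem i⟩) (φ ⟨f j, mem j⟩) := fun {i j} h h' => by
    have hij : X.Adj (f i) (f j) := φ.map_adj_iff.1 h'
    rw [SimpleGraph.dist_eq_one_iff_adj.2 hij] at h
    omega
  have ne : ∀ {i j}, X.dist (f i) (f j) = 2 → φ ⟨f i, mem i⟩ ≠ φ ⟨f j, mem j⟩ := fun {i j} h h' => by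
    have hij : f i = f j := congrArg Subtype.val (φ.injective h')
    rw [hij, SimpleGraph.dist_self] at h
    omega
  obtain ⟨m, hm1, hm2, hm3⟩ := cubeGraph_exists_adj (adj (h1 0)) (adj (h1 1)) (adj (h1 2))
    (adj (h1 3)) (ne (h2 0)) (ne (h2 1)) (ne (h2 2)) (nadj (h3 0)) (nadj (h3 1))
  obtain ⟨⟨m, hm⟩, rfl⟩ := φ.surjective m
  exact ⟨m, φ.map_adj_iff.1 hm1, φ.map_adj_iff.1 hm2, φ.map_adj_iff.1 hm3⟩

theorem quadrangle_condition (hX : IsQuasiMedian X) {u v w z : V} (hzv : X.Adj z v)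
    (hzw : X.Adj z w) (hne : v ≠ w) (hd : X.dist u v = X.dist u w)
    (hz : X.dist u z = X.dist u v + 1) :
    ¬ X.Adj v w ∧ ∃ y, X.Adj y v ∧ X.Adj y w ∧ X.dist u y + 1 = X.dist u v := by
  have hn : ¬ X.Adj v w := by
    intro h
    obtain ⟨y, hyv, hyw, hy⟩ := triangle_condition hX h hd
    have hyz : y ≠ z := by rintro rfl; omega
    have := adj_of_common_triangle hX h hyv.symm hyw.symm hzv.symm hzw.symm hyz
    have := dist_le_dist_add_one hX this.symm u
    omega
  refine ⟨hn, ?_⟩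
  have hvw := dist_eq_two hzv hzw hne hn
  obtain ⟨⟨y₁, y₂, y₃⟩, ⟨k, ⟨h12, h13, h23, k12, k13, k23⟩, -⟩, -⟩ :=
    hX.uniqueQuasiMedian u v w
  simp only [OnGeod] at *
  have zero : ∀ {a b : V}, X.dist a b = 0 → a = b := fun h => hX.connected.dist_eq_zero_iff.1 h
  have one : ∀ {a b : V}, X.dist a b = 1 → X.Adj a b := fun h =>
    SimpleGraph.dist_eq_one_iff_adj.1 h
  have comm : ∀ a b : V, X.dist a b = X.dist b a := fun _ _ => SimpleGraph.dist_comm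
  have tri : ∀ a b c : V, X.dist a c ≤ X.dist a b + X.dist b c :=
    fun _ _ _ => hX.connected.dist_triangle
  have c1 := comm v y₂
  have c2 := comm w y₃
  have hk : k = 0 ∨ k = 2 := by omega
  rcases hk with rfl | rfl
  · obtain rfl := zero k12
    obtain rfl := zero k13
    have h1 : X.dist v y₁ = 1 := by omega
    have h2 : X.dist y₁ w = 1 := by omega
    exact ⟨y₁, (one h1).symm, one h2, by omega⟩
  · obtain rfl := zero (a := v) (b := y₂) (by omega)
    obtain rfl := zero (a := w) (b := y₃) (by omega)
    rename' y₁ => a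
    by_contra! hc
    have near : ∀ m, X.Adj a m → X.Adj m v → X.Adj m w → False := by
      intro m h1 h2 h3
      refine hc m h2 h3 ?_
      have := dist_le_dist_add_one hX h1.symm u
      have := dist_le_dist_add_one hX h2.symm u
      omega
    have haz : X.dist a z = 3 := by
      have := dist_le_dist_add_one hX hzv a
      have := tri u a z
      omega
    have mid : ∀ {b c : V}, X.dist b c = 2 → ∃ m, X.Adj b m ∧ X.Adj m c := by
      intro b c h
      obtain ⟨p, hp⟩ := hX.connected.exists_walk_length_eq_dist b c
      rw [h] at hp
      match p, hp with
      | .cons h1 (.cons h2 .nil), _ => exact ⟨_, h1, h2⟩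
    have triangle : ∀ {p q : V}, X.Adj a p → X.Adj p v → X.Adj a q → X.Adj q w →
        ¬ X.Adj p q := by
      intro p q hap hpv haq hqw hpq
      have h1 := dist_le_dist_add_one hX hpv z
      have h2 := dist_le_dist_add_one hX hqw z
      have h3 := dist_le_dist_add_one hX hap z
      have h4 := dist_le_dist_add_one hX haq z
      have := SimpleGraph.dist_eq_one_iff_adj.2 hzv
      have := SimpleGraph.dist_eq_one_iff_adj.2 hzw
      have := comm a z
      obtain ⟨r, hrp, hrq, hr⟩ := triangle_condition hX hpq (x := z) (by omega)
      have har : a ≠ r := by rintro rfl; omega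
      have := adj_of_common_triangle hX hpq hap.symm haq.symm hrp.symm hrq.symm har
      have := dist_le_dist_add_one hX this z
      omega
    obtain ⟨p, hap, hpv⟩ := mid k12
    obtain ⟨q, haq, hqw⟩ := mid k13
    have side : ∀ {b c p q : V}, X.Adj a p → X.Adj p b → X.Adj a q → X.Adj q c →
        X.dist a b = 2 → X.dist a c = 2 → X.dist b c = 2 →
        (∀ m, X.Adj a m → X.Adj m b → X.Adj m c → False) →
        (∀ q', X.Adj a q' → X.Adj q' c → ¬ X.Adj p q') → X.dist p c = 3 := by
      intro b c p q hap hpb haq hqc hab hac hbc hm ht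
      have h1 := dist_le_dist_add_one hX hap.symm c
      have h2 := dist_le_dist_add_one hX hpb c
      have h5 := dist_le_dist_add_one hX hap c
      have e1 := comm c p
      have e2 := comm c a
      have e3 := comm c b
      have h3 : X.dist p c ≠ 1 := fun h => hm p hap hpb (one h)
      have h4 : X.dist p c ≠ 2 := by
        intro h
        obtain ⟨x, hxa, hxp, hx⟩ := triangle_condition hX hap (x := c) (by omega)
        exact ht x hxa.symm (one (a := c) (by omega)).symm hxp.symm
      omega
    have hpw := side hap hpv haq hqw k12 k13 hvw near fun _ => triangle hap hpv
    have hqv := side haq hqw hap hpv k13 k12 (by rw [comm]; exact hvw)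
      (fun m h1 h2 h3 => near m h1 h3 h2) fun _ h1 h2 h => triangle h1 h2 haq hqw h.symm
    have hpq : p ≠ q := by rintro rfl; exact near p hap hpv hqw
    have h1 : X.dist p z = 2 := by
      refine dist_eq_two hpv.symm hzv.symm ?_ fun h => ?_
      · rintro rfl; have := SimpleGraph.dist_eq_one_iff_adj.2 hap; omega
      · have := dist_le_dist_add_one hX h.symm a
        have := SimpleGraph.dist_eq_one_iff_adj.2 hap
        omega
    have h2 : X.dist z q = 2 := by
      rw [comm]
      refine dist_eq_two hqw.symm hzw.symm ?_ fun h => ?_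
      · rintro rfl; have := SimpleGraph.dist_eq_one_iff_adj.2 haq; omega
      · have := dist_le_dist_add_one hX h.symm a
        have := SimpleGraph.dist_eq_one_iff_adj.2 haq
        omega
    have h3 : X.dist q p = 2 :=
      dist_eq_two haq hap hpq.symm fun h => triangle hap hpv haq hqw h.symm
    obtain ⟨m, hm1, hm2, hm3⟩ := exists_adj_of_isometric_hexagon hX hap hpv hzv.symm hzw hqw.symm
      haq.symm k12 h1 hvw h2 (by rw [comm]; exact k13) h3 haz hpw (by rw [comm]; exact hqv)
    exact near m hm1 hm2 hm3

/-- If a triangle and a square share a side, they span a prism. -/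
theorem exists_prism (hX : IsQuasiMedian X) {a b c d e : V} (hab : X.Adj a b) (hcd : X.Adj c d)
    (hac : X.Adj a c) (hbd : X.Adj b d) (had : a ≠ d) (hbc : b ≠ c) (nad : ¬ X.Adj a d)
    (nbc : ¬ X.Adj b c) (hea : X.Adj e a) (heb : X.Adj e b) :
    ∃ f, X.Adj f e ∧ X.Adj f c ∧ X.Adj f d := by
  have hec : X.dist e c = 2 := dist_eq_two hea.symm hac (by rintro rfl; exact nbc heb.symm)
    fun h => nbc (adj_of_common_triangle hX hea heb hab h hac hbc)
  have hed : X.dist e d = 2 := dist_eq_two heb.symm hbd (by rintro rfl; exact nad hea.symm)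
    fun h => nad (adj_of_common_triangle hX heb hea hab.symm h hbd had)
  obtain ⟨f, hfc, hfd, hf⟩ := triangle_condition hX hcd (hec.trans hed.symm)
  exact ⟨f, (SimpleGraph.dist_eq_one_iff_adj.1 (by omega)).symm, hfc, hfd⟩

theorem dist_lt_of_square (hX : IsQuasiMedian X) {a b c d x : V} (hab : X.Adj a b)
    (hcd : X.Adj c d) (hac : X.Adj a c) (hbd : X.Adj b d) (had : a ≠ d) (hbc : b ≠ c)
    (nad : ¬ X.Adj a d) (nbc : ¬ X.Adj b c) (hx : X.dist x a < X.dist x b) :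
    X.dist x c < X.dist x d := by
  by_contra! hle
  have h1 := dist_le_dist_add_one hX hab.symm x
  have h2 := dist_le_dist_add_one hX hbd x
  have h3 := dist_le_dist_add_one hX hac.symm x
  obtain h | h : X.dist x d = X.dist x a ∨ X.dist x d = X.dist x a + 1 := by omega
  · obtain ⟨-, z, hza, hzd, hz⟩ := quadrangle_condition hX hab.symm hbd had h.symm (by omega)
    rcases eq_or_eq_or_eq_of_common_adj hX had nad hab hac hza.symm hbd.symm hcd.symm hzd.symm
      with rfl | rfl | rfl
    · exact hbc rfl
    · omega
    · omega
  · obtain ⟨z, hzc, hzd, hz⟩ := triangle_condition hX hcd (x := x) (by omega)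
    have nza : ¬ X.Adj z a := fun h =>
      nad (adj_of_common_triangle hX hzc h hac.symm hzd hcd had)
    have nzb : ¬ X.Adj z b := fun h =>
      nbc (adj_of_common_triangle hX hzd h hbd.symm hzc hcd.symm hbc)
    have hza : z ≠ a := by rintro rfl; exact nad hzd
    obtain ⟨e, hez, hea, heb⟩ := exists_prism hX hcd hab hac.symm hbd.symm hbc.symm had.symm
      (fun h => nbc h.symm) (fun h => nad h.symm) hzc hzd
    have nec : ¬ X.Adj e c := fun h =>
      nza (adj_of_common_triangle hX h hez hzc.symm hea hac.symm hza)
    have hec : e ≠ c := by rintro rfl; exact nbc heb.symm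
    have hxe : X.dist x e = X.dist x a + 1 := by
      have := dist_le_dist_add_one hX hea x
      have := dist_le_dist_add_one hX heb.symm x
      have : X.dist x e ≠ X.dist x a := by
        intro h
        obtain ⟨y, hye, hya, hy⟩ := triangle_condition hX hea h
        have hyb : y ≠ b := by rintro rfl; omega
        have := dist_le_dist_add_one hX (adj_of_common_triangle hX hea hye.symm hya.symm heb hab
          hyb).symm x
        omega
      omega
    obtain ⟨-, y, hya, hyz, hy⟩ := quadrangle_condition hX hac.symm hzc.symm hza.symm
      (u := x) (by omega) (by omega)
    rcases eq_or_eq_or_eq_of_common_adj hX hza nza hez.symm hzc hyz.symm hea.symm hac hya.symm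
      with rfl | rfl | rfl
    · exact hec rfl
    · omega
    · omega

/-- The maximal clique containing an edge. -/
def edgeClique (X : SimpleGraph V) (e : Sym2 V) : Set V :=
  {c | ∀ x ∈ e, c = x ∨ X.Adj c x}

theorem mem_edgeClique {a b c : V} :
    c ∈ edgeClique X s(a, b) ↔ (c = a ∨ X.Adj c a) ∧ (c = b ∨ X.Adj c b) := by
  simp [edgeClique]

theorem left_mem_edgeClique {a b : V} (hab : X.Adj a b) : a ∈ edgeClique X s(a, b) :=
  mem_edgeClique.2 ⟨.inl rfl, .inr hab⟩

theorem right_mem_edgeClique {a b : V} (hab : X.Adj a b) : b ∈ edgeClique X s(a, b) :=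
  mem_edgeClique.2 ⟨.inr hab.symm, .inl rfl⟩

theorem adj_of_mem_edgeClique (hX : IsQuasiMedian X) {a b c d : V} (hab : X.Adj a b)
    (hc : c ∈ edgeClique X s(a, b)) (hd : d ∈ edgeClique X s(a, b)) (hcd : c ≠ d) :
    X.Adj c d := by
  rw [mem_edgeClique] at hc hd
  obtain ⟨rfl | hca, hcb⟩ := hc
  · exact (hd.1.resolve_left hcd.symm).symm
  obtain rfl | hcb := hcb
  · exact (hd.2.resolve_left hcd.symm).symm
  obtain ⟨rfl | hda, hdb⟩ := hd
  · exact hca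
  obtain rfl | hdb := hdb
  · exact hcb
  exact adj_of_common_triangle hX hab hca.symm hcb.symm hda.symm hdb.symm hcd

theorem edgeClique_eq_of_mem (hX : IsQuasiMedian X) {a b c d : V} (hab : X.Adj a b)
    (hc : c ∈ edgeClique X s(a, b)) (hd : d ∈ edgeClique X s(a, b)) (hcd : c ≠ d) :
    edgeClique X s(c, d) = edgeClique X s(a, b) := by
  have sub : ∀ {a b c d x : V}, X.Adj a b → c ∈ edgeClique X s(a, b) →
      d ∈ edgeClique X s(a, b) → x ∈ edgeClique X s(a, b) → x ∈ edgeClique X s(c, d) := by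
    intro a b c d x hab hc hd hx
    exact mem_edgeClique.2 ⟨or_iff_not_imp_left.2 (adj_of_mem_edgeClique hX hab hx hc),
      or_iff_not_imp_left.2 (adj_of_mem_edgeClique hX hab hx hd)⟩
  ext x
  exact ⟨sub (adj_of_mem_edgeClique hX hab hc hd hcd) (sub hab hc hd (left_mem_edgeClique hab))
    (sub hab hc hd (right_mem_edgeClique hab)), sub hab hc hd⟩

theorem exists_gate_edgeClique (hX : IsQuasiMedian X) {a b : V} (hab : X.Adj a b) (x : V) :
    ∃ p ∈ edgeClique X s(a, b), ∀ c ∈ edgeClique X s(a, b), c ≠ p →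
      X.dist x c = X.dist x p + 1 := by
  obtain ⟨p, hp, hmin⟩ := exists_minimalFor_of_wellFoundedLT (· ∈ edgeClique X s(a, b))
    (X.dist x) ⟨a, left_mem_edgeClique hab⟩
  have hmin' : ∀ c ∈ edgeClique X s(a, b), X.dist x p ≤ X.dist x c := fun c hc =>
    (le_total _ _).elim id fun h => hmin hc h
  refine ⟨p, hp, fun c hc hcp => ?_⟩
  have hadj := adj_of_mem_edgeClique hX hab hc hp hcp
  have h1 := dist_le_dist_add_one hX hadj x
  have h2 := hmin' c hc
  have h3 : X.dist x c ≠ X.dist x p := by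
    intro h
    obtain ⟨z, hzc, hzp, hz⟩ := triangle_condition hX hadj h
    have := hmin' z (edgeClique_eq_of_mem hX hab hc hp hcp ▸
      mem_edgeClique.2 ⟨.inr hzc, .inr hzp⟩)
    omega
  omega

/-- `x` and `y` have different gates in the maximal clique containing `e`. -/
def CliqueSeparates (X : SimpleGraph V) (e : Sym2 V) (x y : V) : Prop :=
  ∃ c ∈ edgeClique X e, ∃ d ∈ edgeClique X e,
    X.dist x c < X.dist x d ∧ X.dist y d < X.dist y c

theorem cliqueSeparates_of_square (hX : IsQuasiMedian X) {a b c d x y : V} (hab : X.Adj a b)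
    (hcd : X.Adj c d) (hac : X.Adj a c) (hbd : X.Adj b d) (had : a ≠ d) (hbc : b ≠ c)
    (h : CliqueSeparates X s(a, b) x y) : CliqueSeparates X s(c, d) x y := by
  by_cases nad : X.Adj a d
  · have h1 := adj_of_common_triangle hX nad hab hbd.symm hac hcd.symm hbc
    have := edgeClique_eq_of_mem hX hab (mem_edgeClique.2 ⟨.inr hac.symm, .inr h1.symm⟩)
      (mem_edgeClique.2 ⟨.inr nad.symm, .inr hbd.symm⟩) hcd.ne
    rwa [CliqueSeparates, this]
  have nbc : ¬ X.Adj b c := fun h =>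
    nad (adj_of_common_triangle hX h hab.symm hac.symm hbd hcd had)
  have disj : ∀ p ∈ edgeClique X s(a, b), p ∉ edgeClique X s(c, d) := by
    intro p hp hp'
    rw [mem_edgeClique] at hp hp'
    obtain ⟨rfl | h1, rfl | h2⟩ := hp <;> obtain ⟨h3 | h3, h4 | h4⟩ := hp'
    all_goals try subst_vars
    all_goals first
      | exact nad (by assumption)
      | exact nbc (by assumption)
      | exact had rfl
      | exact hbc rfl
      | exact nbc (SimpleGraph.Adj.symm (by assumption))
      | exact nad (SimpleGraph.Adj.symm (by assumption))
      | exact nad (adj_of_common_triangle hX h3 h1 hac.symm h4 hcd had)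
  have par : ∀ p ∈ edgeClique X s(a, b), ∃ p' ∈ edgeClique X s(c, d), X.Adj p p' := by
    intro p hp
    rw [mem_edgeClique] at hp
    obtain ⟨rfl | h1, h2⟩ := hp
    · exact ⟨c, left_mem_edgeClique hcd, hac⟩
    obtain rfl | h2 := h2
    · exact ⟨d, right_mem_edgeClique hcd, hbd⟩
    obtain ⟨f, hfp, hfc, hfd⟩ := exists_prism hX hab hcd hac hbd had hbc nad nbc h1 h2
    exact ⟨f, mem_edgeClique.2 ⟨.inr hfc, .inr hfd⟩, hfp.symm⟩
  obtain ⟨p, hp, q, hq, h1, h2⟩ := h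
  have hpq : p ≠ q := by rintro rfl; omega
  obtain ⟨p', hp', hpp⟩ := par p hp
  obtain ⟨q', hq', hqq⟩ := par q hq
  have hne : p' ≠ q' := by
    rintro rfl
    exact disj p' (edgeClique_eq_of_mem hX hab hp hq hpq ▸
      mem_edgeClique.2 ⟨.inr hpp.symm, .inr hqq.symm⟩) hp'
  have hpq' : p ≠ q' := fun h => disj p hp (h ▸ hq')
  have hqp' : q ≠ p' := fun h => disj q hq (h ▸ hp')
  have npq : ¬ X.Adj p q' := fun h => disj p hp (edgeClique_eq_of_mem hX hcd hp' hq' hne ▸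
      mem_edgeClique.2 ⟨.inr hpp, .inr h⟩)
  have nqp : ¬ X.Adj q p' := fun h => disj q hq (edgeClique_eq_of_mem hX hcd hp' hq' hne ▸
      mem_edgeClique.2 ⟨.inr h, .inr hqq⟩)
  have apq := adj_of_mem_edgeClique hX hab hp hq hpq
  have apq' := adj_of_mem_edgeClique hX hcd hp' hq' hne
  exact ⟨p', hp', q', hq', dist_lt_of_square hX apq apq' hpp hqq hpq' hqp' npq nqp h1,
    dist_lt_of_square hX apq.symm apq'.symm hqq hpp hqp' hpq' nqp npq h2⟩

theorem SideRel.symm {e f : Sym2 V} (h : SideRel X e f) : SideRel X f e := by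
  rcases h with ⟨a, b, c, hab, hac, hbc, rfl, rfl⟩ |
    ⟨a, b, c, d, hab, hcd, hac, hbd, had, hbc, rfl, rfl⟩
  · exact .inl ⟨a, c, b, hac, hab, hbc.symm, rfl, rfl⟩
  · exact .inr ⟨c, d, a, b, hcd, hab, hac.symm, hbd.symm, hbc.symm, had.symm, rfl, rfl⟩

theorem SideRel.mem_edgeSet {e f : Sym2 V} (h : SideRel X e f) : e ∈ X.edgeSet := by
  rcases h with ⟨a, b, c, hab, hac, hbc, rfl, rfl⟩ |
    ⟨a, b, c, d, hab, hcd, hac, hbd, had, hbc, rfl, rfl⟩ <;> exact hab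

theorem SideRel.cliqueSeparates (hX : IsQuasiMedian X) {e f : Sym2 V} (h : SideRel X e f)
    {x y : V} (hs : CliqueSeparates X e x y) : CliqueSeparates X f x y := by
  rcases h with ⟨a, b, c, hab, hac, hbc, rfl, rfl⟩ |
    ⟨a, b, c, d, hab, hcd, hac, hbd, had, hbc, rfl, rfl⟩
  · have := edgeClique_eq_of_mem hX hab (left_mem_edgeClique hab)
      (mem_edgeClique.2 ⟨.inr hac.symm, .inr hbc.symm⟩) hac.ne
    rwa [CliqueSeparates, this]
  · exact cliqueSeparates_of_square hX hab hcd hac hbd had hbc hs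

theorem cliqueSeparates_iff_of_eqvGen (hX : IsQuasiMedian X) {e f : Sym2 V}
    (h : Relation.EqvGen (SideRel X) e f) (x y : V) :
    CliqueSeparates X e x y ↔ CliqueSeparates X f x y := by
  induction h with
  | rel e f h => exact ⟨h.cliqueSeparates hX, h.symm.cliqueSeparates hX⟩
  | refl => rfl
  | symm _ _ _ ih => exact ih.symm
  | trans _ _ _ _ _ ih ih' => exact ih.trans ih'

theorem mem_edgeSet_iff_of_eqvGen {e f : Sym2 V} (h : Relation.EqvGen (SideRel X) e f) :
    e ∈ X.edgeSet ↔ f ∈ X.edgeSet := by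
  induction h with
  | rel e f h => exact ⟨fun _ => h.symm.mem_edgeSet, fun _ => h.mem_edgeSet⟩
  | refl => rfl
  | symm _ _ _ ih => exact ih.symm
  | trans _ _ _ _ _ ih ih' => exact ih.trans ih'

theorem Hyperplane.mem_edgeSet (H : Hyperplane X) {e : Sym2 V} (he : e ∈ H.1) :
    e ∈ X.edgeSet := by
  obtain ⟨H, e₀, h₀, rfl⟩ := H
  exact (mem_edgeSet_iff_of_eqvGen he).1 h₀

theorem Hyperplane.eqvGen (H : Hyperplane X) {e f : Sym2 V} (he : e ∈ H.1) (hf : f ∈ H.1) :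
    Relation.EqvGen (SideRel X) e f := by
  obtain ⟨H, e₀, h₀, rfl⟩ := H
  exact .trans _ _ _ (.symm _ _ he) hf

theorem Hyperplane.mem_of_eqvGen (H : Hyperplane X) {e f : Sym2 V} (he : e ∈ H.1)
    (h : Relation.EqvGen (SideRel X) e f) : f ∈ H.1 := by
  obtain ⟨H, e₀, h₀, rfl⟩ := H
  exact .trans _ _ _ he h

theorem Hyperplane.eq_of_mem {H K : Hyperplane X} {e : Sym2 V} (hH : e ∈ H.1) (hK : e ∈ K.1) :
    H = K :=
  Subtype.ext <| Set.ext fun _ =>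
    ⟨fun h => K.mem_of_eqvGen hK (H.eqvGen hH h), fun h => H.mem_of_eqvGen hH (K.eqvGen hK h)⟩

theorem Hyperplane.mem_of_triangle (H : Hyperplane X) {a b c : V} (h : s(a, b) ∈ H.1)
    (hac : X.Adj a c) (hbc : X.Adj b c) : s(a, c) ∈ H.1 :=
  H.mem_of_eqvGen h (.rel _ _ (.inl ⟨a, b, c, H.mem_edgeSet h, hac, hbc, rfl, rfl⟩))

theorem Hyperplane.mem_of_square (H : Hyperplane X) {a b c d : V} (h : s(a, b) ∈ H.1)
    (hcd : X.Adj c d) (hac : X.Adj a c) (hbd : X.Adj b d) (had : a ≠ d) (hbc : b ≠ c) :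
    s(c, d) ∈ H.1 :=
  H.mem_of_eqvGen h
    (.rel _ _ (.inr ⟨a, b, c, d, H.mem_edgeSet h, hcd, hac, hbd, had, hbc, rfl, rfl⟩))

theorem Hyperplane.mem_of_mem_edgeClique (H : Hyperplane X) {a b c : V} (h : s(a, b) ∈ H.1)
    (hc : c ∈ edgeClique X s(a, b)) (hne : c ≠ a) : s(a, c) ∈ H.1 := by
  rw [mem_edgeClique] at hc
  obtain rfl | hcb := hc.2
  · exact h
  · exact H.mem_of_triangle h (hc.1.resolve_left hne).symm hcb.symm

theorem mem_hypCarrier {H : Hyperplane X} {s : V} :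
    s ∈ hypCarrier X H ↔ ∃ a, X.Adj s a ∧ s(s, a) ∈ H.1 := by
  constructor
  · rintro ⟨e, he, hs⟩
    obtain ⟨a, rfl⟩ := Sym2.mem_iff_exists.1 hs
    exact ⟨a, H.mem_edgeSet he, he⟩
  · rintro ⟨a, -, h⟩
    exact ⟨_, h, Sym2.mem_mk_left _ _⟩

theorem mem_hypCarrier_right {H : Hyperplane X} {s a : V} (h : s(a, s) ∈ H.1) :
    s ∈ hypCarrier X H :=
  ⟨_, h, Sym2.mem_mk_right _ _⟩

/-- An edge of the carrier of `H` belongs to `H` or spans a square with each edge of `H` at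
its origin. -/
theorem mem_or_exists_square (hX : IsQuasiMedian X) {H : Hyperplane X} {s a u : V}
    (hsa : s(s, a) ∈ H.1) (hu : u ∈ hypCarrier X H) (hsu : X.Adj s u) :
    s(s, u) ∈ H.1 ∨ (a ≠ u ∧ ¬ X.Adj a u ∧
      ∃ b, X.Adj u b ∧ X.Adj a b ∧ s(u, b) ∈ H.1 ∧ s ≠ b ∧ ¬ X.Adj s b) := by
  have adj : X.Adj s a := H.mem_edgeSet hsa
  by_cases hmem : u ∈ edgeClique X s(s, a)
  · exact .inl (H.mem_of_mem_edgeClique hsa hmem hsu.ne')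
  have hau : a ≠ u := by rintro rfl; exact hmem (right_mem_edgeClique hsu)
  have nau : ¬ X.Adj a u := fun h => hmem (mem_edgeClique.2 ⟨.inr hsu.symm, .inr h.symm⟩)
  refine .inr ⟨hau, nau, ?_⟩
  obtain ⟨b, hub, hb⟩ := mem_hypCarrier.1 hu
  have key := cliqueSeparates_iff_of_eqvGen hX (H.eqvGen hsa hb)
  have dsu := SimpleGraph.dist_eq_one_iff_adj.2 hsu
  have dus := SimpleGraph.dist_eq_one_iff_adj.2 hsu.symm
  have dsa := SimpleGraph.dist_eq_one_iff_adj.2 adj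
  have das := SimpleGraph.dist_eq_one_iff_adj.2 adj.symm
  have nsep : ¬ CliqueSeparates X s(s, a) s u := by
    rintro ⟨c, hc, d, hd, h1, h2⟩
    have : X.dist s d ≤ 1 := by
      obtain rfl | h := (mem_edgeClique.1 hd).1
      · simp
      · exact (SimpleGraph.dist_eq_one_iff_adj.2 h.symm).le
    obtain rfl : s = c := hX.connected.dist_eq_zero_iff.1 (by omega)
    obtain rfl : u = d := hX.connected.dist_eq_zero_iff.1 (by omega)
    exact hmem hd
  obtain ⟨c, hc, d, hd, h1, h2⟩ := (key s a).1
    ⟨s, left_mem_edgeClique adj, a, right_mem_edgeClique adj, by simp [dsa], by simp [das]⟩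
  rw [key] at nsep
  obtain ⟨p, hp, hgate⟩ := exists_gate_edgeClique hX hub s
  obtain rfl : p = u := by
    by_contra hne
    refine nsep ⟨p, hp, u, left_mem_edgeClique hub, ?_, ?_⟩
    · rw [hgate u (left_mem_edgeClique hub) (Ne.symm hne)]; omega
    · have := adj_of_mem_edgeClique hX hub hp (left_mem_edgeClique hub) hne
      simp [SimpleGraph.dist_eq_one_iff_adj.2 this.symm]
  have hdp : d ≠ p := by
    rintro rfl
    by_cases hcd : c = d
    · subst hcd; omega
    · have := hgate c hc hcd; omega
  have hsd := hgate d hd hdp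
  obtain rfl : c = p := by
    by_contra hcp
    have := hgate c hc hcp
    omega
  have h3 := dist_le_dist_add_one hX hsu.symm a
  have had : a ≠ d := by
    rintro rfl
    exact nau ((mem_edgeClique.1 hd).1.resolve_left hau)
  have h4 : X.dist a d ≠ 0 := fun h => had (hX.connected.dist_eq_zero_iff.1 h)
  refine ⟨d, ((mem_edgeClique.1 hd).1.resolve_left hdp).symm,
    SimpleGraph.dist_eq_one_iff_adj.1 (by omega), H.mem_of_mem_edgeClique hb hd hdp, ?_, ?_⟩
  · rintro rfl
    simp at hsd
  · intro h
    have := SimpleGraph.dist_eq_one_iff_adj.2 h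
    omega

theorem mem_hypCarrier_of_triangle (hX : IsQuasiMedian X) {H : Hyperplane X} {s u y : V}
    (hs : s ∈ hypCarrier X H) (hu : u ∈ hypCarrier X H) (hsu : X.Adj s u) (hys : X.Adj y s)
    (hyu : X.Adj y u) : y ∈ hypCarrier X H := by
  obtain ⟨a, hsa, ha⟩ := mem_hypCarrier.1 hs
  obtain h | ⟨hau, nau, b, hub, hab, hb, hsb, nsb⟩ := mem_or_exists_square hX ha hu hsu
  · exact mem_hypCarrier_right (H.mem_of_triangle h hys.symm hyu.symm)
  · obtain ⟨f, hfy, hfa, hfb⟩ := exists_prism hX hsu hab hsa hub hsb hau.symm nsb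
      (fun h => nau h.symm) hys hyu
    refine mem_hypCarrier.2 ⟨f, hfy.symm, H.mem_of_square ha hfy.symm hys.symm hfa.symm ?_ ?_⟩
    · rintro rfl; exact nsb hfb
    · rintro rfl; exact nau hyu

theorem mem_hypCarrier_of_square (hX : IsQuasiMedian X) {H : Hyperplane X} {s t y y' : V}
    (hs : s ∈ hypCarrier X H) (ht : t ∈ hypCarrier X H) (hy : y ∈ hypCarrier X H)
    (hst : X.Adj s t) (hsy : X.Adj s y) (hty : t ≠ y) (nty : ¬ X.Adj t y)
    (hyt' : X.Adj y' t) (hyy' : X.Adj y' y) : y' ∈ hypCarrier X H := by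
  by_cases hsy' : s = y'
  · exact hsy' ▸ hs
  have nsy' : ¬ X.Adj s y' := fun h =>
    nty (adj_of_common_triangle hX h hst hyt' hsy hyy' hty)
  obtain ⟨a, hsa, ha⟩ := mem_hypCarrier.1 hs
  obtain h | ⟨hat, nat, b, htb, hab, hb, hsb, nsb⟩ := mem_or_exists_square hX ha ht hst
  · exact mem_hypCarrier_right (H.mem_of_square h hyy'.symm hsy hyt'.symm hsy' hty)
  obtain h | ⟨hay, nay, b', hyb, hab', hb', hsb', nsb'⟩ := mem_or_exists_square hX ha hy hsy
  · exact mem_hypCarrier_right (H.mem_of_square h hyt'.symm hst hyy'.symm hsy' hty.symm)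
  by_cases hy'b : X.Adj y' b
  · exact mem_hypCarrier_right (H.mem_of_triangle hb hyt'.symm hy'b.symm)
  by_cases hy'b' : X.Adj y' b'
  · exact mem_hypCarrier_right (H.mem_of_triangle hb' hyy'.symm hy'b'.symm)
  have hbb' : b ≠ b' := by
    rintro rfl
    rcases eq_or_eq_or_eq_of_common_adj hX hsb nsb hst hsy hsa htb.symm hyb.symm hab.symm
      with h | h | h
    exacts [hty h, hat h.symm, hay h.symm]
  have hay' : a ≠ y' := by rintro rfl; exact nat hyt'
  have nay' : ¬ X.Adj y' a := fun h => by
    rcases eq_or_eq_or_eq_of_common_adj hX hsy' nsy' hst hsy hsa hyt' hyy' h with h | h | h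
    exacts [hty h, hat h.symm, hay h.symm]
  have hby' : b ≠ y' := by rintro rfl; exact nay' hab.symm
  have hby'' : b' ≠ y' := by rintro rfl; exact nay' hab'.symm
  have dt : X.dist a t = 2 := dist_eq_two hsa hst hat nat
  have hday' : X.dist y' a = 3 := by
    rw [SimpleGraph.dist_comm]
    have h1 := dist_le_dist_add_one hX hyt' a
    have h2 : X.dist a y' ≠ 0 := fun h => hay' (hX.connected.dist_eq_zero_iff.1 h)
    have h3 : X.dist a y' ≠ 1 := fun h => nay' (SimpleGraph.dist_eq_one_iff_adj.1 h).symm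
    have h4 : X.dist a y' ≠ 2 := by
      intro h
      obtain ⟨z, hzy', hzt, hz⟩ := triangle_condition hX hyt' (h.trans dt.symm)
      have haz : X.Adj a z := SimpleGraph.dist_eq_one_iff_adj.1 (by omega)
      rcases eq_or_eq_or_eq_of_common_adj hX hat nat hsa.symm hab haz hst.symm htb hzt.symm
        with rfl | rfl | rfl
      exacts [hsb rfl, nsy' hzy', hy'b hzy'.symm]
    omega
  have d1 : X.dist y' b = 2 := dist_eq_two hyt'.symm htb hby'.symm hy'b
  have d2 : X.dist y' b' = 2 := dist_eq_two hyy'.symm hyb hby''.symm hy'b'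
  obtain ⟨-, z, hzb, hzb', hz⟩ := quadrangle_condition hX hab hab' hbb' (d1.trans d2.symm)
    (by omega)
  have hy'z : X.Adj y' z := SimpleGraph.dist_eq_one_iff_adj.1 (by omega)
  have htz : t ≠ z := by
    rintro rfl
    rcases eq_or_eq_or_eq_of_common_adj hX hat nat hsa.symm hab hab' hst.symm htb hzb'
      with h | h | h
    exacts [hsb h, hsb' h, hbb' h]
  exact mem_hypCarrier.2 ⟨z, hy'z, H.mem_of_square hb hy'z hyt'.symm hzb.symm htz hby'⟩

theorem hypCarrier_preconnected (H : Hyperplane X) :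
    (X.induce (hypCarrier X H)).Preconnected := by
  have step : ∀ {a b : V} (ha : a ∈ hypCarrier X H) (hb : b ∈ hypCarrier X H), X.Adj a b →
      (X.induce (hypCarrier X H)).Reachable ⟨a, ha⟩ ⟨b, hb⟩ := fun ha hb h =>
    SimpleGraph.Adj.reachable (SimpleGraph.induce_adj.2 h)
  have edge : ∀ {e : Sym2 V}, e ∈ H.1 → ∀ {a b : V} (ha : a ∈ hypCarrier X H)
      (hb : b ∈ hypCarrier X H), a ∈ e → b ∈ e →
      (X.induce (hypCarrier X H)).Reachable ⟨a, ha⟩ ⟨b, hb⟩ := by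
    intro e he a b ha hb hae hbe
    by_cases hab : a = b
    · subst hab; exact .refl _
    · obtain rfl := (Sym2.mem_and_mem_iff hab).1 ⟨hae, hbe⟩
      exact step ha hb (H.mem_edgeSet he)
  have key : ∀ {e f : Sym2 V}, Relation.EqvGen (SideRel X) e f → e ∈ H.1 → ∀ {a b : V}
      (ha : a ∈ hypCarrier X H) (hb : b ∈ hypCarrier X H), a ∈ e → b ∈ f →
      (X.induce (hypCarrier X H)).Reachable ⟨a, ha⟩ ⟨b, hb⟩ := by
    intro e f h
    induction h with
    | rel e f h =>
      intro he x y hx hy hxe hyf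
      have hf := H.mem_of_eqvGen he (.rel _ _ h)
      obtain ⟨p, q, hp, hq, hpe, hqf, hpq⟩ : ∃ (p q : V) (hp : p ∈ hypCarrier X H)
          (hq : q ∈ hypCarrier X H), p ∈ e ∧ q ∈ f ∧
          (X.induce (hypCarrier X H)).Reachable ⟨p, hp⟩ ⟨q, hq⟩ := by
        rcases h with ⟨a, b, c, -, -, -, rfl, rfl⟩ | ⟨a, b, c, d, -, -, hac, -, -, -, rfl, rfl⟩
        · exact ⟨a, a, ⟨_, he, Sym2.mem_mk_left _ _⟩, ⟨_, he, Sym2.mem_mk_left _ _⟩,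
            Sym2.mem_mk_left _ _, Sym2.mem_mk_left _ _, .refl _⟩
        · exact ⟨a, c, ⟨_, he, Sym2.mem_mk_left _ _⟩, ⟨_, hf, Sym2.mem_mk_left _ _⟩,
            Sym2.mem_mk_left _ _, Sym2.mem_mk_left _ _, step _ _ hac⟩
      exact ((edge he hx hp hxe hpe).trans hpq).trans (edge hf hq hy hqf hyf)
    | refl e => exact fun he _ _ ha hb hae hbe => edge he ha hb hae hbe
    | symm e f h ih =>
      exact fun hf _ _ ha hb haf hbe =>
        (ih (H.mem_of_eqvGen hf (.symm _ _ h)) hb ha hbe haf).symm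
    | trans e f g h h' ih ih' =>
      intro he a b ha hb hae hbg
      have hf := H.mem_of_eqvGen he h
      induction f using Sym2.ind with
      | _ c d =>
        have hc : c ∈ hypCarrier X H := ⟨_, hf, Sym2.mem_mk_left _ _⟩
        exact (ih he ha hc hae (Sym2.mem_mk_left _ _)).trans
          (ih' hf hc hb (Sym2.mem_mk_left _ _) hbg)
  rintro ⟨a, e, he, hae⟩ ⟨b, f, hf, hbf⟩
  exact key (H.eqvGen he hf) he _ _ hae hbf

/-- In a set of vertices which is connected and contains the common neighbours of its pairs of
vertices at distance at most two, a local minimum of the distance to `v` is a gate for `v`. -/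
theorem isGate_of_forall_adj_le (hX : IsQuasiMedian X) {S : Set V}
    (hconn : (X.induce S).Preconnected)
    (htri : ∀ {s u y : V}, s ∈ S → u ∈ S → X.Adj s u → X.Adj y s → X.Adj y u → y ∈ S)
    (hsq : ∀ {s t y y' : V}, s ∈ S → t ∈ S → y ∈ S → X.Adj s t → X.Adj s y → t ≠ y →
      ¬ X.Adj t y → X.Adj y' t → X.Adj y' y → y' ∈ S)
    {v w : V} (hw : w ∈ S) (hmin : ∀ c ∈ S, X.Adj w c → X.dist v w ≤ X.dist v c) :
    IsGate X S v w := by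
  have key : ∀ v, (∀ c ∈ S, X.Adj w c → X.dist v w ≤ X.dist v c) → ∀ n, ∀ u : S,
      (X.induce S).dist ⟨w, hw⟩ u = n → X.dist v u = X.dist v w + n := by
    clear hmin v
    intro v hmin n
    induction n using Nat.strong_induction_on with
    | _ n ih =>
    have pred : ∀ {m} {u : S}, (X.induce S).dist ⟨w, hw⟩ u = m + 1 →
        ∃ s : S, X.Adj s u ∧ (X.induce S).dist ⟨w, hw⟩ s = m := by
      intro m u hu
      obtain ⟨p, hp⟩ := (hconn u ⟨w, hw⟩).exists_walk_length_eq_dist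
      rw [SimpleGraph.dist_comm, hu] at hp
      match p, hp with
      | .cons (v := s) h p, hp =>
        refine ⟨s, (SimpleGraph.induce_adj.1 h).symm, le_antisymm ?_ ?_⟩
        · rw [SimpleGraph.dist_comm]
          have := SimpleGraph.dist_le p
          simp at hp
          omega
        · obtain ⟨q, hq⟩ := (hconn ⟨w, hw⟩ s).exists_walk_length_eq_dist
          have := SimpleGraph.dist_le (q.concat h.symm)
          rw [SimpleGraph.Walk.length_concat] at this
          omega
    have next : ∀ {s u : S}, X.Adj s u →
        (X.induce S).dist ⟨w, hw⟩ u ≤ (X.induce S).dist ⟨w, hw⟩ s + 1 := by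
      intro s u h
      obtain ⟨q, hq⟩ := (hconn ⟨w, hw⟩ s).exists_walk_length_eq_dist
      have := SimpleGraph.dist_le (q.concat (SimpleGraph.induce_adj.2 h))
      rwa [SimpleGraph.Walk.length_concat, hq] at this
    intro u hu
    obtain _ | n := n
    · obtain rfl := ((hconn _ _).dist_eq_zero_iff).1 hu
      rfl
    obtain ⟨s, hsu, hs⟩ := pred hu
    have hvs := ih n (by omega) s hs
    have h1 := dist_le_dist_add_one hX hsu v
    have h2 := dist_le_dist_add_one hX hsu.symm v
    by_contra hne
    obtain ⟨y, hys, hyu, hy⟩ : ∃ y : S, X.Adj y s ∧ (y = u ∨ X.Adj y u) ∧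
        X.dist v y + 1 = X.dist v s := by
      obtain h | h : X.dist v s = X.dist v u ∨ X.dist v u + 1 = X.dist v s := by omega
      · obtain ⟨y, hys, hyu, hy⟩ := triangle_condition hX hsu h
        exact ⟨⟨y, htri s.2 u.2 hsu hys hyu⟩, hys, .inr hyu, hy⟩
      · exact ⟨u, hsu.symm, .inl rfl, h⟩
    have hyn : n ≤ (X.induce S).dist ⟨w, hw⟩ y := by
      obtain rfl | h := hyu
      · omega
      · have := next h; omega
    obtain _ | n := n
    · obtain rfl := ((hconn _ _).dist_eq_zero_iff).1 hs
      have := hmin y y.2 hys.symm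
      dsimp only at *
      omega
    obtain ⟨t, hts, ht⟩ := pred hs
    have hvt := ih n (by omega) t ht
    have hty : (t : V) ≠ y := fun h => by
      rw [Subtype.ext h] at ht
      omega
    obtain ⟨nty, y', hy't, hy'y, hy'⟩ := quadrangle_condition hX hts.symm hys.symm hty
      (u := v) (by omega) (by omega)
    have hy'S := hsq s.2 t.2 y.2 hts.symm hys.symm hty nty hy't hy'y
    have h3 := next (s := t) (u := ⟨y', hy'S⟩) hy't.symm
    have h4 := next (s := ⟨y', hy'S⟩) (u := y) hy'y
    have h5 := ih _ (by omega) ⟨y', hy'S⟩ rfl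
    dsimp only at h5
    omega
  refine ⟨hw, fun q hq => ?_⟩
  have h1 := key v hmin _ ⟨q, hq⟩ rfl
  have h2 := key w (fun _ _ _ => by simp) _ ⟨q, hq⟩ rfl
  simp only [SimpleGraph.dist_self] at h1 h2
  omega

/-- If `w` lies in the carrier of `H` but is not the gate for `v` there, then some hyperplane
dual to the first edge of a geodesic from `w` to `v` equals `H` or intersects `H`. -/
theorem exists_adj_of_not_isGate (hX : IsQuasiMedian X) {H : Hyperplane X} {v w : V}
    (hw : w ∈ hypCarrier X H) (hg : ¬ IsGate X (hypCarrier X H) v w) :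
    ∃ (K : Hyperplane X) (c : V), X.Adj w c ∧ X.dist v c < X.dist v w ∧ s(w, c) ∈ K.1 ∧
      (K = H ∨ HypIntersect X H K) := by
  obtain ⟨c, hc, hwc, hlt⟩ : ∃ c ∈ hypCarrier X H, X.Adj w c ∧ X.dist v c < X.dist v w := by
    by_contra! h
    exact hg (isGate_of_forall_adj_le hX (hypCarrier_preconnected H)
      (mem_hypCarrier_of_triangle hX) (mem_hypCarrier_of_square hX) hw h)
  obtain ⟨a, hwa, ha⟩ := mem_hypCarrier.1 hw
  obtain h | ⟨hac, nac, b, hcb, hab, -, hwb, -⟩ := mem_or_exists_square hX ha hc hwc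
  · exact ⟨H, c, hwc, hlt, h, .inl rfl⟩
  · exact ⟨⟨_, s(w, c), hwc, rfl⟩, c, hwc, hlt, .refl _, .inr ⟨w, _, ha, _, .refl _, a, c, rfl, rfl,
      hwa, hwc, hac, nac, b, hwb.symm, hab, hcb⟩⟩

/-- Distinct hyperplanes dual to first edges of geodesics from `w` to `v` intersect. -/
theorem hypIntersect_of_dist_lt (hX : IsQuasiMedian X) {H K : Hyperplane X} {v w a b : V}
    (hwa : X.Adj w a) (hwb : X.Adj w b) (ha : X.dist v a < X.dist v w)
    (hb : X.dist v b < X.dist v w) (hH : s(w, a) ∈ H.1) (hK : s(w, b) ∈ K.1) (hne : H ≠ K) :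
    HypIntersect X H K := by
  have h1 := dist_le_dist_add_one hX hwa v
  have h2 := dist_le_dist_add_one hX hwb v
  have hab : a ≠ b := by rintro rfl; exact hne (Hyperplane.eq_of_mem hH hK)
  obtain ⟨nab, y, hya, hyb, hy⟩ := quadrangle_condition hX hwa hwb hab (u := v)
    (by omega) (by omega)
  refine ⟨w, _, hH, _, hK, a, b, rfl, rfl, hwa, hwb, hab, nab, y, ?_, hya.symm, hyb.symm⟩
  rintro rfl
  omega

/-- Distinct hyperplanes whose carriers share a vertex intersect or osculate. -/
theorem hypIntersect_or_hypOsculate {H K : Hyperplane X} {w : V} (hH : w ∈ hypCarrier X H)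
    (hK : w ∈ hypCarrier X K) (hne : H ≠ K) : HypIntersect X H K ∨ HypOsculate X H K := by
  obtain ⟨a, hwa, ha⟩ := mem_hypCarrier.1 hH
  obtain ⟨b, hwb, hb⟩ := mem_hypCarrier.1 hK
  have hab : a ≠ b := by rintro rfl; exact hne (Hyperplane.eq_of_mem ha hb)
  have nab : ¬ X.Adj a b := fun h =>
    hne (Hyperplane.eq_of_mem (H.mem_of_triangle ha hwb h) hb)
  by_cases h : ∃ q : V, q ≠ w ∧ X.Adj a q ∧ X.Adj b q
  · exact .inl ⟨w, _, ha, _, hb, a, b, rfl, rfl, hwa, hwb, hab, nab, h⟩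
  · exact .inr ⟨w, _, ha, _, hb, a, b, rfl, rfl, hwa, hwb, hab, nab, h⟩

end QuasiMedianGraph

section SpecialAction

variable {V G : Type*} [Group G] {X : SimpleGraph V} (α : GraphAction G X)

theorem GraphAction.hypImage_one (S : Set (Sym2 V)) : α.hypImage 1 S = S := by
  have : α.act 1 = id := funext α.act_one
  simp [GraphAction.hypImage, this]

theorem GraphAction.hypImage_mul (g h : G) (S : Set (Sym2 V)) :
    α.hypImage (g * h) S = α.hypImage g (α.hypImage h S) := by
  have : α.act (g * h) = α.act g ∘ α.act h := funext (α.act_mul g h)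
  simp only [GraphAction.hypImage, this, Sym2.map_comp, Set.image_comp]

theorem sameOrbit_equivalence : Equivalence (SameOrbit α) where
  refl H := ⟨1, (α.hypImage_one _).symm⟩
  symm := by
    rintro H K ⟨g, h⟩
    exact ⟨g⁻¹, by rw [h, ← α.hypImage_mul, inv_mul_cancel, α.hypImage_one]⟩
  trans := by
    rintro H K L ⟨g, h⟩ ⟨g', h'⟩
    exact ⟨g' * g, by rw [h', h, α.hypImage_mul]⟩

theorem sameOrbit_of_mk_eq {H K : Hyperplane X}
    (h : Quot.mk (SameOrbit α) H = Quot.mk (SameOrbit α) K) : SameOrbit α H K :=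
  (sameOrbit_equivalence α).eqvGen_iff.1 (Quot.eqvGen_exact h)

theorem injOn_mk_of_mem_hypCarrier (hsp : IsSpecial α) {w : V} {S : Set (Hyperplane X)}
    (hS : ∀ H ∈ S, w ∈ hypCarrier X H) : Set.InjOn (Quot.mk (SameOrbit α)) S := by
  intro H hH K hK h
  by_contra hne
  exact hsp.1 H K (sameOrbit_of_mk_eq α h) hne
    (hypIntersect_or_hypOsculate (hS H hH) (hS K hK) hne)

theorem mk_mem_insert_neighborSet {H K : Hyperplane X} (h : K = H ∨ HypIntersect X H K) :
    Quot.mk (SameOrbit α) H ∈ insert (Quot.mk (SameOrbit α) K)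
      ((quotCrossingGraph α).neighborSet (Quot.mk (SameOrbit α) K)) := by
  by_cases hq : Quot.mk (SameOrbit α) H = Quot.mk (SameOrbit α) K
  · exact .inl hq
  have hHK : H ≠ K := fun h => hq (h ▸ rfl)
  refine .inr ⟨Ne.symm hq, .inr ⟨H, K, rfl, rfl, ?_⟩⟩
  exact (SimpleGraph.fromRel_adj _ _ _).2 ⟨hHK, .inl (h.resolve_left hHK.symm)⟩

/-- At most `D + 1` hyperplanes through a vertex are equal to or intersect a given one. -/
theorem ncard_le_of_forall_hypIntersect (hsp : IsSpecial α) {D : ℕ} (hD : QuotDegBounded α D)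
    {w : V} {S : Set (Hyperplane X)} (hS : ∀ H ∈ S, w ∈ hypCarrier X H) (K : Hyperplane X)
    (hK : ∀ H ∈ S, K = H ∨ HypIntersect X H K) : S.Finite ∧ S.ncard ≤ D + 1 := by
  obtain ⟨hfin, hcard⟩ := hD (Quot.mk (SameOrbit α) K)
  have hinj := injOn_mk_of_mem_hypCarrier α hsp hS
  have hmaps : Set.MapsTo (Quot.mk (SameOrbit α)) S (insert (Quot.mk (SameOrbit α) K)
      ((quotCrossingGraph α).neighborSet (Quot.mk (SameOrbit α) K))) :=
    fun H hH => mk_mem_insert_neighborSet α (hK H hH)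
  have hfin' := hfin.insert (Quot.mk (SameOrbit α) K)
  refine ⟨Set.Finite.of_injOn hmaps hinj hfin', ?_⟩
  exact (Set.ncard_le_ncard_of_injOn _ hmaps hinj hfin').trans
    ((Set.ncard_insert_le _ _).trans (Nat.succ_le_succ hcard))

end SpecialAction

/-- **Lemma.** Suppose `G` acts specially on a quasi-median graph `X` and every vertex of
`ΔX/G` has at most `D` neighbours. Then for any vertices `v`, `w` of `X` there are at most
`(D+1)²` hyperplanes `H` such that `w` lies in the carrier `N(H)` but `w` is not the gate
for `v` in `N(H)`. -/
theorem few_bad_hyperplanes {V : Type*} {G : Type*} [Group G]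
    (X : SimpleGraph V) (hX : IsQuasiMedian X) (α : GraphAction G X) (hsp : IsSpecial α)
    (D : ℕ) (hD : QuotDegBounded α D) (v w : V) :
    {H : Hyperplane X | w ∈ hypCarrier X H ∧ ¬ IsGate X (hypCarrier X H) v w}.Finite ∧
    {H : Hyperplane X | w ∈ hypCarrier X H ∧ ¬ IsGate X (hypCarrier X H) v w}.ncard ≤
      (D + 1) ^ 2 := by
  set B := {H : Hyperplane X | w ∈ hypCarrier X H ∧ ¬ IsGate X (hypCarrier X H) v w}
  let F : Set (Hyperplane X) :=
    {K | ∃ c, X.Adj w c ∧ X.dist v c < X.dist v w ∧ s(w, c) ∈ K.1}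
  have hF : F.Finite ∧ F.ncard ≤ D + 1 := by
    obtain h | ⟨K, c, hwc, hc, hcK⟩ := F.eq_empty_or_nonempty
    · simp [h]
    refine ncard_le_of_forall_hypIntersect α hsp hD (w := w) ?_ K ?_
    · rintro H ⟨a, hwa, -, ha⟩
      exact mem_hypCarrier.2 ⟨a, hwa, ha⟩
    · rintro H ⟨a, hwa, ha, haH⟩
      exact or_iff_not_imp_left.2 fun hne =>
        hypIntersect_of_dist_lt hX hwa hwc ha hc haH hcK (Ne.symm hne)
  have hB : ∀ K, {H ∈ B | K = H ∨ HypIntersect X H K}.Finite ∧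
      {H ∈ B | K = H ∨ HypIntersect X H K}.ncard ≤ D + 1 := fun K =>
    ncard_le_of_forall_hypIntersect α hsp hD (fun H hH => hH.1.1) K fun H hH => hH.2
  have hsub : B ⊆ ⋃ K ∈ hF.1.toFinset, {H ∈ B | K = H ∨ HypIntersect X H K} := by
    intro H hH
    obtain ⟨K, c, hwc, hc, hcK, hK⟩ := exists_adj_of_not_isGate hX hH.1 hH.2
    exact Set.mem_biUnion (by simpa using ⟨c, hwc, hc, hcK⟩) ⟨hH, hK⟩
  have hfin : (⋃ K ∈ hF.1.toFinset, {H ∈ B | K = H ∨ HypIntersect X H K}).Finite :=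
    hF.1.toFinset.finite_toSet.biUnion fun K _ => (hB K).1
  refine ⟨hfin.subset hsub, (Set.ncard_le_ncard hsub hfin).trans ?_⟩
  calc _ ≤ ∑ K ∈ hF.1.toFinset, {H ∈ B | K = H ∨ HypIntersect X H K}.ncard :=
        Finset.set_ncard_biUnion_le _ _
    _ ≤ hF.1.toFinset.card * (D + 1) := Finset.sum_le_card_nsmul _ _ _ fun K _ => (hB K).2
    _ ≤ (D + 1) ^ 2 := by
        rw [← Set.ncard_eq_toFinset_card _ hF.1, sq]
        exact Nat.mul_le_mul_right _ hF.2

end QM
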